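/- Let p, q, m be integers with p, q, m ≥ 2 and 1/p + 1/q + 1/m ≤ 1. Then the triangle group Δ(p,q,m) = ⟨f, g, h ∣ f^m, g^p, h^q, fgh⟩ is an infinite group. -/

import Mathlib

/-- The relators of the triangle group Δ(p,q,r) = ⟨f, g, h ∣ f^r, g^p, h^q, fgh⟩,
where f, g, h are the generators indexed by 0, 1, 2 in `Fin 3`. -/
def triangleRels (p q r : ℕ) : Set (FreeGroup (Fin 3)) :=
  {FreeGroup.of 0 ^ r, FreeGroup.of 1 ^ p, FreeGroup.of 2 ^ q,
    FreeGroup.of 0 * FreeGroup.of 1 * FreeGroup.of 2}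

/-- The triangle group Δ(p,q,r) = ⟨f, g, h ∣ f^r, g^p, h^q, fgh⟩. -/
abbrev TriangleGroup (p q r : ℕ) : Type := PresentedGroup (triangleRels p q r)

open Matrix
open scoped MatrixGroups commutatorElement

/-- Powers of a matrix in `SL₂` are linear combinations of the matrix and the identity, with
coefficients given by the linear recurrence of its trace. -/
lemma SL2_pow_succ_eq {R : Type*} [CommRing R] (M : SL(2, R)) (u : ℕ → R) (h0 : u 0 = 0)
    (hu : ∀ k, u (k + 2) = M.1.trace * u (k + 1) - u k) (k : ℕ) :
    u 1 • (M.1 ^ (k + 1)) = u (k + 1) • M.1 - u k • (1 : Matrix (Fin 2) (Fin 2) R) := by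
  have hCH : M.1 * M.1 = M.1.trace • M.1 - (1 : Matrix (Fin 2) (Fin 2) R) := by
    have hdet := M.2
    rw [det_fin_two] at hdet
    ext i j
    fin_cases i <;> fin_cases j <;> simp [mul_apply, trace_fin_two] <;> grind
  induction k with
  | zero => simp [h0]
  | succ k ih =>
    rw [pow_succ, ← smul_mul_assoc, ih, sub_mul, smul_mul_assoc, smul_mul_assoc, one_mul, hCH, hu]
    module

/-- A matrix in `SL₂(ℂ)` of trace `2 cos (π / n)` has `n`-th power `-1`. -/
lemma SL2_pow_eq_neg_one {n : ℕ} (hn : 2 ≤ n) (M : SL(2, ℂ))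
    (hM : M.1.trace = 2 * Complex.cos (Real.pi / n)) : M ^ n = -1 := by
  obtain ⟨k, rfl⟩ : ∃ k, n = k + 1 := ⟨n - 1, by omega⟩
  set θ : ℝ := Real.pi / (k + 1 : ℕ) with hθ
  have hn0 : ((k + 1 : ℕ) : ℝ) ≠ 0 := by positivity
  have hs : Complex.sin θ ≠ 0 := by
    rw [← Complex.ofReal_sin, Complex.ofReal_ne_zero]
    refine (Real.sin_pos_of_pos_of_lt_pi (by positivity) ?_).ne'
    exact div_lt_self Real.pi_pos (by exact_mod_cast hn)
  have hmul : ((k + 1 : ℕ) : ℂ) * θ = Real.pi := by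
    rw [hθ]; push_cast at hn0 ⊢; field_simp
  have key := SL2_pow_succ_eq M (fun j => Complex.sin (j * θ)) (by simp) (fun j => by
    have hM' : M.1.trace = 2 * Complex.cos θ := by rw [hM, hθ]; push_cast; rfl
    have e1 : ((j + 2 : ℕ) : ℂ) * θ = (j + 1 : ℕ) * θ + θ := by push_cast; ring
    have e2 : (j : ℂ) * θ = (j + 1 : ℕ) * θ - θ := by push_cast; ring
    simp only [hM']
    rw [e1, e2, Complex.sin_add, Complex.sin_sub]
    ring) k
  have hk : (k : ℂ) * θ = Real.pi - θ := by rw [← hmul]; push_cast; ring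
  simp only [hmul, hk, Complex.sin_pi_sub, Complex.sin_pi, Nat.cast_one, one_mul, zero_smul,
    zero_sub, ← smul_neg] at key
  apply Subtype.ext
  simpa using smul_right_injective _ hs key

/-- A matrix in `SL₂(ℂ)` with real trace at least `2`, a nontrivial power of which is scalar, is
the identity. -/
lemma SL2_eq_one_of_pow_mem_center (M : SL(2, ℂ)) {t : ℝ} (ht : 2 ≤ t) (hM : M.1.trace = t)
    {n : ℕ} (hn : 0 < n) (hc : M ^ n ∈ Subgroup.center SL(2, ℂ)) : M = 1 := by
  obtain ⟨k, rfl⟩ : ∃ k, n = k + 1 := ⟨n - 1, by omega⟩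
  obtain ⟨c, -, hc⟩ := Matrix.SpecialLinearGroup.mem_center_iff.1 hc
  let v : ℕ → ℝ × ℝ := fun j => Nat.rec (0, 1) (fun _ w => (w.2, t * w.2 - w.1)) j
  have hv : ∀ j, 0 ≤ (v j).1 ∧ (v j).1 < (v j).2 := by
    intro j
    induction j with
    | zero => simp [v]
    | succ j ih =>
      change 0 ≤ (v j).2 ∧ (v j).2 < t * (v j).2 - (v j).1
      constructor <;> nlinarith
  have key := SL2_pow_succ_eq M (fun j => ((v j).1 : ℂ)) (by simp [v]) (fun j => by
    change (((t * (v j).2 - (v j).1 : ℝ)) : ℂ) = M.1.trace * ((v j).2 : ℝ) - ((v j).1 : ℝ)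
    rw [hM]; push_cast; rfl) k
  have hpos : ((v (k + 1)).1 : ℂ) ≠ 0 :=
    Complex.ofReal_ne_zero.2 ((hv k).1.trans_lt (hv k).2).ne'
  have h1 : (v 1).1 = 1 := rfl
  rw [Matrix.SpecialLinearGroup.coe_pow] at hc
  simp only [h1, Complex.ofReal_one, one_smul, ← hc] at key
  have e00 := congrFun (congrFun key 0) 0
  have e01 := congrFun (congrFun key 0) 1
  have e10 := congrFun (congrFun key 1) 0
  have e11 := congrFun (congrFun key 1) 1
  simp [hpos] at e00 e01 e10 e11
  have hdet := M.2
  rw [trace_fin_two] at hM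
  have hd : M.1 0 0 = M.1 1 1 := mul_left_cancel₀ hpos (by linear_combination e11 - e00)
  rw [det_fin_two, e01, hd] at hdet
  rw [hd] at hM
  have h4 : (t : ℂ) ^ 2 = 4 := by rw [← hM]; linear_combination 4 * hdet
  have ht2 : t = 2 := by
    have : t ^ 2 = 4 := by exact_mod_cast h4
    nlinarith
  have h11 : M.1 1 1 = 1 := by
    rw [ht2] at hM; push_cast at hM; linear_combination hM / 2
  ext i j
  fin_cases i <;> fin_cases j <;> simp [e01, e10, hd, h11]

/-- The Fricke formula for the trace of a commutator in `SL₂`. -/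
lemma SL2_trace_commutator {R : Type*} [CommRing R] (A B : SL(2, R)) :
    (⁅A, B⁆ : SL(2, R)).1.trace = A.1.trace ^ 2 + B.1.trace ^ 2 + (A * B).1.trace ^ 2
      - A.1.trace * B.1.trace * (A * B).1.trace - 2 := by
  have hA := A.2
  have hB := B.2
  rw [det_fin_two] at hA hB
  simp only [commutatorElement_def, Matrix.SpecialLinearGroup.coe_mul,
    Matrix.SpecialLinearGroup.coe_inv, adjugate_fin_two, trace_fin_two, mul_apply,
    Fin.sum_univ_two, of_apply, cons_val', cons_val_zero, cons_val_one, cons_val_fin_one]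
  grind

lemma one_le_cos_sq_add_of_add_le_pi {α β γ : ℝ} (hα : 0 ≤ α) (hβ : 0 ≤ β) (hγ : 0 ≤ γ)
    (h : α + β + γ ≤ Real.pi) :
    1 ≤ Real.cos α ^ 2 + Real.cos β ^ 2 + Real.cos γ ^ 2
      + 2 * Real.cos α * Real.cos β * Real.cos γ := by
  have h1 : Real.cos (Real.pi - (α + β)) ≤ Real.cos γ :=
    Real.cos_le_cos_of_nonneg_of_le_pi hγ (by linarith) (by linarith)
  rw [Real.cos_pi_sub, Real.cos_add] at h1
  have h2 : 0 ≤ Real.sin α * Real.sin β :=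
    mul_nonneg (Real.sin_nonneg_of_nonneg_of_le_pi hα (by linarith))
      (Real.sin_nonneg_of_nonneg_of_le_pi hβ (by linarith))
  have h3 : (Real.sin α * Real.sin β) ^ 2 ≤ (Real.cos γ + Real.cos α * Real.cos β) ^ 2 :=
    pow_le_pow_left₀ h2 (by linarith) 2
  rw [mul_pow, Real.sin_sq, Real.sin_sq] at h3
  linarith

/-- If `sin β ≠ 0`, there are noncommuting matrices `A`, `B` in `SL₂(ℂ)` such that `A`, `B`, `A * B`
have traces `2 cos α`, `2 cos β` and `z`. -/
lemma exists_SL2_trace_eq (α β z : ℂ) (hβ : Complex.sin β ≠ 0) :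
    ∃ A B : SL(2, ℂ), A.1.trace = 2 * Complex.cos α ∧ B.1.trace = 2 * Complex.cos β ∧
      (A * B).1.trace = z ∧ ⁅A, B⁆ ≠ 1 := by
  let e : ℂ → ℂ := fun x => Complex.exp (x * Complex.I)
  have he : ∀ x, e x * e (-x) = 1 := fun x => by
    simp only [e]; rw [← Complex.exp_add]; simp
  have hcos : ∀ x, 2 * Complex.cos x = e x + e (-x) := fun x => by
    rw [Complex.two_cos]
  let s : ℂ := z - e α * e β - e (-α) * e (-β)
  obtain ⟨A, hA⟩ : ∃ A : SL(2, ℂ), A.1 = !![e α, 1; 0, e (-α)] :=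
    ⟨⟨_, by simp [det_fin_two, he]⟩, rfl⟩
  obtain ⟨B, hB⟩ : ∃ B : SL(2, ℂ), B.1 = !![e β, 0; s, e (-β)] :=
    ⟨⟨_, by simp [det_fin_two, he]⟩, rfl⟩
  refine ⟨A, B, ?_, ?_, ?_, fun h => ?_⟩
  · simp [hA, trace_fin_two, hcos]
  · simp [hB, trace_fin_two, hcos]
  · simp [hA, hB, trace_fin_two, s]
    ring
  · rw [commutatorElement_eq_one_iff_mul_comm] at h
    have h01 := congrFun (congrFun (congrArg Subtype.val h) 0) 1
    simp [hA, hB] at h01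
    apply hβ
    have h2 := Complex.two_sin β
    change 2 * Complex.sin β = (e (-β) - e β) * Complex.I at h2
    rw [h01, sub_self, zero_mul] at h2
    simpa using h2

theorem triangleGroup_infinite (p q m : ℕ) (hp : 2 ≤ p) (hq : 2 ≤ q) (hm : 2 ≤ m)
    (h : (1 : ℚ) / p + 1 / q + 1 / m ≤ 1) :
    Infinite (TriangleGroup p q m) := by
  have hsin : Complex.sin (Real.pi / q : ℝ) ≠ 0 := by
    rw [← Complex.ofReal_sin, Complex.ofReal_ne_zero]
    exact (Real.sin_pos_of_pos_of_lt_pi (by positivity)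
      (div_lt_self Real.pi_pos (by exact_mod_cast hq))).ne'
  obtain ⟨A, B, hA, hB, hAB, hne⟩ := exists_SL2_trace_eq (Real.pi / p : ℝ) (Real.pi / q : ℝ)
    (-(2 * Complex.cos (Real.pi / m : ℝ))) hsin
  have hangle : Real.pi / p + Real.pi / q + Real.pi / m ≤ Real.pi := by
    have hR : (1 : ℝ) / p + 1 / q + 1 / m ≤ 1 := by
      have := (Rat.cast_le (K := ℝ)).2 h
      push_cast at this
      exact this
    calc Real.pi / p + Real.pi / q + Real.pi / m
        = Real.pi * (1 / p + 1 / q + 1 / m) := by ring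
      _ ≤ Real.pi := mul_le_of_le_one_right Real.pi_pos.le hR
  have htrig := one_le_cos_sq_add_of_add_le_pi (by positivity) (by positivity) (by positivity)
    hangle
  have htr := SL2_trace_commutator A B
  rw [hA, hB, hAB] at htr
  let π : SL(2, ℂ) →* SL(2, ℂ) ⧸ Subgroup.center SL(2, ℂ) := QuotientGroup.mk' _
  have hπ : ∀ M, π M = 1 ↔ M ∈ Subgroup.center SL(2, ℂ) := QuotientGroup.eq_one_iff
  have hneg : π (-1) = 1 := (hπ _).2 (Subgroup.mem_center_iff.2 fun M => by simp)
  have hAp : A ^ p = -1 := SL2_pow_eq_neg_one hp A (by rw [hA]; push_cast; rfl)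
  have hBq : B ^ q = -1 := SL2_pow_eq_neg_one hq B (by rw [hB]; push_cast; rfl)
  have hABm : (-(A * B)) ^ m = -1 := SL2_pow_eq_neg_one hm _ (by
    rw [Matrix.SpecialLinearGroup.coe_neg, trace_neg, hAB]; push_cast; ring)
  have hπAB : π (A * B) = π (-(A * B)) := by
    rw [← neg_one_mul (A * B), map_mul π (-1), hneg, one_mul]
  let F : Fin 3 → SL(2, ℂ) ⧸ Subgroup.center SL(2, ℂ) := ![π (A * B)⁻¹, π A, π B]
  have hF : ∀ r ∈ triangleRels p q m, FreeGroup.lift F r = 1 := by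
    rintro r (rfl | rfl | rfl | rfl)
    · simp only [map_pow, FreeGroup.lift_apply_of, F, cons_val_zero]
      rw [map_inv, inv_pow, hπAB, ← map_pow, hABm, hneg, inv_one]
    · simp only [map_pow, FreeGroup.lift_apply_of, F, cons_val]
      rw [← map_pow, hAp, hneg]
    · simp only [map_pow, FreeGroup.lift_apply_of, F, cons_val]
      rw [← map_pow, hBq, hneg]
    · simp [F]
  let φ : TriangleGroup p q m →* SL(2, ℂ) ⧸ Subgroup.center SL(2, ℂ) :=
    PresentedGroup.toGroup hF
  by_contra hinf
  rw [not_infinite_iff_finite] at hinf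
  let c : TriangleGroup p q m :=
    ⁅(PresentedGroup.of 1 : TriangleGroup p q m), (PresentedGroup.of 2 : TriangleGroup p q m)⁆
  have hφc : φ c = π ⁅A, B⁆ := by
    simp [φ, c, map_commutatorElement, F]
  refine hne (SL2_eq_one_of_pow_mem_center ⁅A, B⁆
    (t := 4 * (Real.cos (Real.pi / p) ^ 2 + Real.cos (Real.pi / q) ^ 2
      + Real.cos (Real.pi / m) ^ 2
      + 2 * Real.cos (Real.pi / p) * Real.cos (Real.pi / q) * Real.cos (Real.pi / m)) - 2)
    (by linarith) (by rw [htr]; push_cast; ring) (orderOf_pos c) ((hπ _).1 ?_))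
  rw [map_pow, ← hφc, ← map_pow, pow_orderOf_eq_one, map_one]
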